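/- Let G₁ be the simple graph on vertex set {1,…,8} with edge set E₁ = {{1,7},{1,2},{2,3},{3,4},{4,5},{5,6},{6,7},{7,8},{2,8},{2,5},{5,8}}, and let G₂ be the simple graph on the same vertex set with edge set E₂ = {{1,7},{1,2},{2,4},{4,5},{5,7},{7,8},{2,8},{2,5},{3,5},{3,6},{6,8}}. Then for every pair of natural numbers (i,j), the number of subsets S ⊆ E₁ with |S| = j and r₁(S) = i equals the number of subsets S ⊆ E₂ with |S| = j and r₂(S) = i, where rᵢ(S) = 8 − (number of connected components of the spanning subgraph of Gᵢ with edge set S). In other words, G₁ and G₂ have the same Whitney rank generating function. -/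

import Mathlib

open Finset SimpleGraph MvPolynomial

/-- Edge set of the first Schwärzler graph `G₁` on vertices `{1,…,8}`,
encoded on `Fin 8` via `i ↦ i - 1`. -/
def E1 : Finset (Sym2 (Fin 8)) :=
  {s(0,6), s(0,1), s(1,2), s(2,3), s(3,4), s(4,5), s(5,6), s(6,7), s(1,7), s(1,4), s(4,7)}

/-- Edge set of the second Schwärzler graph `G₂` on vertices `{1,…,8}`,
encoded on `Fin 8` via `i ↦ i - 1`. -/
def E2 : Finset (Sym2 (Fin 8)) :=
  {s(0,6), s(0,1), s(1,3), s(3,4), s(4,6), s(6,7), s(1,7), s(1,4), s(2,4), s(2,5), s(5,7)}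

/-- The number of connected components of the spanning subgraph of the complete
graph on `Fin 8` with edge set `S`. -/
noncomputable def numComp (S : Finset (Sym2 (Fin 8))) : ℕ :=
  Nat.card (SimpleGraph.fromEdgeSet (↑S : Set (Sym2 (Fin 8)))).ConnectedComponent

/-- The (matroid) rank of an edge subset `S`: `8` minus the number of connected
components of the spanning subgraph `(V, S)`. -/
noncomputable def rk (S : Finset (Sym2 (Fin 8))) : ℕ := 8 - numComp S

instance (s : Set (Sym2 (Fin 8))) [DecidablePred (· ∈ s)] :
    DecidableRel (SimpleGraph.fromEdgeSet s).Adj := fun a b =>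
  decidable_of_iff (s(a, b) ∈ s ∧ a ≠ b) (SimpleGraph.fromEdgeSet_adj s).symm

/-- The labelling obtained from `f` by giving the class of `v` the label of `u`. -/
def mergeLabels {V : Type*} [DecidableEq V] (f : V → V) (u v : V) : V → V :=
  fun x => if f x = f v then f u else f x

/-- The number of sublists of `l` of length `j` for which merging the labels of `f` along all
chosen pairs leaves a labelling with `Fintype.card V - i` distinct labels (with truncated
subtraction). -/
def rankCount {V : Type*} [Fintype V] [DecidableEq V] (i : ℕ) :
    List (V × V) → ℕ → (V → V) → ℕ
  | [], 0, f => if Fintype.card V - (univ.image f).card = i then 1 else 0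
  | [], _ + 1, _ => 0
  | _ :: l, 0, f => rankCount i l 0 f
  | (u, v) :: l, j + 1, f =>
      rankCount i l (j + 1) f + rankCount i l j (mergeLabels f u v)

/-- The labels of `f` distinguish exactly the connected components of `G`. -/
def IsComponentLabelling {V : Type*} (G : SimpleGraph V) (f : V → V) : Prop :=
  ∀ x y, f x = f y ↔ G.Reachable x y

theorem isComponentLabelling_id {V : Type*} :
    IsComponentLabelling (fromEdgeSet (∅ : Set (Sym2 V))) id := by
  intro x y
  simp

theorem IsComponentLabelling.insert_edge {V : Type*} [DecidableEq V] {T : Set (Sym2 V)} {f : V → V}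
    (hf : IsComponentLabelling (fromEdgeSet T) f) (u v : V) :
    IsComponentLabelling (fromEdgeSet (insert s(u, v) T)) (mergeLabels f u v) := by
  have mono : ∀ {a b}, f a = f b → (fromEdgeSet (insert s(u, v) T)).Reachable a b := fun h =>
    ((hf _ _).1 h).mono (fromEdgeSet_mono (Set.subset_insert _ _))
  have huv : (fromEdgeSet (insert s(u, v) T)).Reachable u v := by
    by_cases h : u = v
    · exact h ▸ Reachable.refl _
    · exact Adj.reachable (by simp [h])
  intro x y
  constructor
  · intro h
    unfold mergeLabels at h
    split_ifs at h with hx hy hy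
    · exact mono (hx.trans hy.symm)
    · exact ((mono hx).trans huv.symm).trans (mono h)
    · exact ((mono h).trans huv).trans (mono hy).symm
    · exact mono h
  · rintro ⟨p⟩
    induction p with
    | nil => rfl
    | @cons a b _ hab _ ih =>
      rw [← ih]
      rw [fromEdgeSet_adj, Set.mem_insert_iff, Sym2.eq_iff] at hab
      unfold mergeLabels
      obtain ⟨(⟨rfl, rfl⟩ | ⟨rfl, rfl⟩) | hT, hne⟩ := hab
      · simp
      · simp
      · rw [(hf a b).2 (Adj.reachable (by simp [hT, hne]))]

theorem IsComponentLabelling.card_connectedComponent {V : Type*} [Fintype V] [DecidableEq V]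
    {G : SimpleGraph V} {f : V → V} (hf : IsComponentLabelling G f) :
    Nat.card G.ConnectedComponent = (univ.image f).card := by
  have e : G.ConnectedComponent ≃ Set.range f :=
    (Quot.congrRight fun x y => (hf x y).symm).trans (Setoid.quotientKerEquivRange f)
  rw [Nat.card_congr e, Nat.card_coe_set_eq, ← Set.ncard_coe_finset]
  simp

theorem card_filter_rk_union_eq_rankCount (i : ℕ) (l : List (Fin 8 × Fin 8)) (j : ℕ)
    (f : Fin 8 → Fin 8) (T : Finset (Sym2 (Fin 8)))
    (hf : IsComponentLabelling (fromEdgeSet (T : Set (Sym2 (Fin 8)))) f)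
    (hl : (l.map fun e => s(e.1, e.2)).Nodup) :
    ((l.map fun e => s(e.1, e.2)).toFinset.powerset.filter
      fun S => S.card = j ∧ rk (S ∪ T) = i).card = rankCount i l j f := by
  induction l generalizing j f T with
  | nil =>
    have hrk : rk T = Fintype.card (Fin 8) - (univ.image f).card := by
      rw [rk, numComp, hf.card_connectedComponent, Fintype.card_fin]
    cases j with
    | zero => simp [rankCount, filter_singleton, hrk, apply_ite Finset.card]
    | succ j => simp [rankCount, filter_singleton]
  | cons e l ih =>
    obtain ⟨u, v⟩ := e
    rw [List.map_cons, List.nodup_cons] at hl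
    have hnot : s(u, v) ∉ (l.map fun e => s(e.1, e.2)).toFinset := by simpa using hl.1
    have hS : ∀ S ∈ (l.map fun e => s(e.1, e.2)).toFinset.powerset, s(u, v) ∉ S :=
      fun S h h' => hnot (mem_powerset.1 h h')
    rw [List.map_cons, List.toFinset_cons, card_filter, sum_powerset_insert hnot,
      ← card_filter, ih j f T hf hl.2]
    have hsum : ∀ S ∈ (l.map fun e => s(e.1, e.2)).toFinset.powerset,
        (if (insert s(u, v) S).card = j ∧ rk (insert s(u, v) S ∪ T) = i then 1 else 0) =
          if S.card + 1 = j ∧ rk (S ∪ insert s(u, v) T) = i then 1 else 0 := by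
      intro S h
      rw [card_insert_of_notMem (hS S h), insert_union, union_insert]
    rw [sum_congr rfl hsum]
    cases j with
    | zero => simp [rankCount]
    | succ j =>
      rw [rankCount, ← ih j _ (insert s(u, v) T) (by simpa using hf.insert_edge u v) hl.2, card_filter]
      simp

theorem card_filter_rk_eq_rankCount (i j : ℕ) (l : List (Fin 8 × Fin 8))
    (hl : (l.map fun e => s(e.1, e.2)).Nodup) :
    ((l.map fun e => s(e.1, e.2)).toFinset.powerset.filter
      fun S => S.card = j ∧ rk S = i).card = rankCount i l j id := by
  simpa using card_filter_rk_union_eq_rankCount i l j id ∅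
    (by simpa using isComponentLabelling_id) hl

theorem card_filter_rk_eq_zero {E : Finset (Sym2 (Fin 8))} {i j : ℕ} (h : E.card < j ∨ 8 < i) :
    (E.powerset.filter fun S => S.card = j ∧ rk S = i).card = 0 := by
  rw [card_eq_zero, filter_eq_empty_iff]
  rintro S hS ⟨rfl, rfl⟩
  have := card_le_card (mem_powerset.1 hS)
  have : rk S ≤ 8 := Nat.sub_le _ _
  omega

/-- The edges of the first Schwärzler graph, as a list of pairs. -/
def edges1 : List (Fin 8 × Fin 8) :=
  [(0,6), (0,1), (1,2), (2,3), (3,4), (4,5), (5,6), (6,7), (1,7), (1,4), (4,7)]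

/-- The edges of the second Schwärzler graph, as a list of pairs. -/
def edges2 : List (Fin 8 × Fin 8) :=
  [(0,6), (0,1), (1,3), (3,4), (4,6), (6,7), (1,7), (1,4), (2,4), (2,5), (5,7)]

theorem rankCount_edges1_eq_edges2 :
    ∀ i < 9, ∀ j < 12, rankCount i edges1 j id = rankCount i edges2 j id := by
  decide +kernel

/-- The two Schwärzler graphs have the same Whitney rank generating function:
for all `(i, j)`, they have the same number of edge subsets of size `j` and rank `i`. -/
theorem whitney_rank_generating_eq (i j : ℕ) :
    (E1.powerset.filter (fun S => S.card = j ∧ rk S = i)).card =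
    (E2.powerset.filter (fun S => S.card = j ∧ rk S = i)).card := by
  have h1 : E1 = (edges1.map fun e => s(e.1, e.2)).toFinset := by decide
  have h2 : E2 = (edges2.map fun e => s(e.1, e.2)).toFinset := by decide
  by_cases h : i < 9 ∧ j < 12
  · rw [h1, h2, card_filter_rk_eq_rankCount i j edges1 (by decide),
      card_filter_rk_eq_rankCount i j edges2 (by decide),
      rankCount_edges1_eq_edges2 i h.1 j h.2]
  · have c1 : E1.card = 11 := by decide
    have c2 : E2.card = 11 := by decide
    rw [card_filter_rk_eq_zero (by omega), card_filter_rk_eq_zero (by omega)]
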